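/- arXiv:math/0703523 — 5 statements merged into one kernel-verified Lean document; each statement's English description precedes it below -/
import Mathlib

section
/- Let A be a real cohomology algebra of dimension 2n and let ω ∈ A² satisfy the Lefschetz property. Then for every odd k, the dimension of A^k over ℝ is even. -/
open TensorProduct

/-- A cohomology algebra of dimension `m` over a field `F`. -/
structure IsCohomologyAlgebra (F : Type) [Field F] (A : Type) [Ring A] [Algebra F A]
    (𝒜 : ℕ → Submodule F A) [GradedAlgebra 𝒜] (m : ℕ) : Prop where
  finite : FiniteDimensional F A
  gcomm : ∀ (k l : ℕ) (x y : A), x ∈ 𝒜 k → y ∈ 𝒜 l →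
    x * y = ((-1 : F) ^ (k * l)) • (y * x)
  degZero : 𝒜 0 ≤ Submodule.span F {(1 : A)}
  vanish : ∀ k, m < k → 𝒜 k = ⊥
  topRank : Module.finrank F ↥(𝒜 m) = 1
  nondeg : ∀ k, k ≤ m → ∀ x ∈ 𝒜 k, x ≠ 0 → ∃ y ∈ 𝒜 (m - k), x * y ≠ 0

/-- `ω` satisfies the (hard) Lefschetz property on a cohomology algebra of dimension `2n`:
for every `k ≤ n`, multiplication by `ω^(n-k)` is an isomorphism `A^k ≃ A^(2n-k)`. -/
def HasLefschetz (F : Type) [Field F] (A : Type) [Ring A] [Algebra F A]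
    (𝒜 : ℕ → Submodule F A) (n : ℕ) (ω : A) : Prop :=
  ∀ k, k ≤ n →
    Submodule.map (LinearMap.mulLeft F (ω ^ (n - k))) (𝒜 k) = 𝒜 (2 * n - k) ∧
    ∀ x ∈ 𝒜 k, ω ^ (n - k) * x = 0 → x = 0

/-- A finite-dimensional real vector space with a nondegenerate skew-symmetric bilinear form
has even dimension. -/
theorem even_finrank_of_skew_nondegenerate {V : Type*} [AddCommGroup V] [Module ℝ V]
    [FiniteDimensional ℝ V] (B : LinearMap.BilinForm ℝ V)
    (hskew : ∀ x y, B x y = -B y x) (hnondeg : ∀ x, x ≠ 0 → ∃ y, B x y ≠ 0) :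
    Even (Module.finrank ℝ V) := by
  let b := Module.finBasis ℝ V
  set M := LinearMap.BilinForm.toMatrix b B with hM
  have hdet : M.det ≠ 0 := by
    rw [hM, ← LinearMap.BilinForm.nondegenerate_iff_det_ne_zero b]
    refine ⟨fun x hx => ?_, fun y hy => ?_⟩
    · by_contra h
      obtain ⟨z, hz⟩ := hnondeg x h
      exact hz (hx z)
    · by_contra h
      obtain ⟨z, hz⟩ := hnondeg y h
      exact hz (by rw [hskew, hy z, neg_zero])
  have htr : M.transpose = -M := by
    ext i j
    simp [hM, LinearMap.BilinForm.toMatrix_apply, hskew (b j) (b i)]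
  by_contra hodd
  have h : M.det = -M.det := by
    conv_lhs => rw [← Matrix.det_transpose, htr, Matrix.det_neg, Fintype.card_fin,
      (Nat.not_even_iff_odd.mp hodd).neg_one_pow, neg_one_mul]
  exact hdet (by linarith)

/-- A linear functional that is faithful on a given line. -/
theorem exists_dual_ne_zero_of_finrank_eq_one {V : Type*} [AddCommGroup V] [Module ℝ V]
    (L : Submodule ℝ V) (hL : Module.finrank ℝ L = 1) :
    ∃ φ : V →ₗ[ℝ] ℝ, ∀ w ∈ L, w ≠ 0 → φ w ≠ 0 := by
  obtain ⟨v, hv, hspan⟩ := finrank_eq_one_iff'.mp hL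
  obtain ⟨φ, hφ⟩ := Module.Projective.exists_dual_ne_zero ℝ (x := (v : V)) (by simpa using hv)
  refine ⟨φ, fun w hw hw0 => ?_⟩
  obtain ⟨c, hc⟩ := hspan ⟨w, hw⟩
  have hcw : c • (v : V) = w := congrArg Subtype.val hc
  rw [← hcw, map_smul, smul_eq_mul]
  refine mul_ne_zero ?_ hφ
  rintro rfl
  exact hw0 (by rw [← hcw, zero_smul])

/-- In degrees up to the middle, odd graded pieces carry a nondegenerate skew form. -/
theorem even_finrank_of_hasLefschetz_of_le (A : Type) [Ring A] [Algebra ℝ A]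
    (𝒜 : ℕ → Submodule ℝ A) [GradedAlgebra 𝒜] (n : ℕ) (hA : IsCohomologyAlgebra ℝ A 𝒜 (2 * n))
    (ω : A) (hω : ω ∈ 𝒜 2) (hLef : HasLefschetz ℝ A 𝒜 n ω) (k : ℕ) (hk : Odd k) (hkn : k ≤ n) :
    Even (Module.finrank ℝ ↥(𝒜 k)) := by
  have := hA.finite
  obtain ⟨φ, hφ⟩ := exists_dual_ne_zero_of_finrank_eq_one (𝒜 (2 * n)) hA.topRank
  have hpow : ω ^ (n - k) ∈ 𝒜 ((n - k) • 2) := SetLike.pow_mem_graded _ hω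
  let B : LinearMap.BilinForm ℝ (𝒜 k) :=
    ((LinearMap.mul ℝ A).compr₂ (φ ∘ₗ LinearMap.mulLeft ℝ (ω ^ (n - k)))).compl₁₂
      (𝒜 k).subtype (𝒜 k).subtype
  have hB : ∀ x y : 𝒜 k, B x y = φ (ω ^ (n - k) * ((x : A) * y)) := fun _ _ => rfl
  refine even_finrank_of_skew_nondegenerate B (fun x y => ?_) (fun x hx => ?_)
  · rw [hB, hB, hA.gcomm k k x y x.2 y.2, (hk.mul hk).neg_one_pow]
    simp
  · have hdeg : ω ^ (n - k) * (x : A) ∈ 𝒜 (2 * n - k) := by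
      have h := SetLike.mul_mem_graded hpow x.2
      rwa [smul_eq_mul, show (n - k) * 2 + k = 2 * n - k by omega] at h
    obtain ⟨y, hy, hxy⟩ := hA.nondeg (2 * n - k) (by omega) _ hdeg
      (fun h => hx (Subtype.ext ((hLef k hkn).2 x x.2 h)))
    have htop := SetLike.mul_mem_graded hdeg hy
    rw [show 2 * n - k + (2 * n - (2 * n - k)) = 2 * n by omega] at htop
    rw [show 2 * n - (2 * n - k) = k by omega] at hy
    refine ⟨⟨y, hy⟩, ?_⟩
    rw [hB, ← mul_assoc]
    exact hφ _ htop hxy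

theorem stmt2 (A : Type) [Ring A] [Algebra ℝ A] (𝒜 : ℕ → Submodule ℝ A)
    [GradedAlgebra 𝒜] (n : ℕ) (hA : IsCohomologyAlgebra ℝ A 𝒜 (2 * n))
    (ω : A) (hω : ω ∈ 𝒜 2) (hLef : HasLefschetz ℝ A 𝒜 n ω) :
    ∀ k : ℕ, Odd k → Even (Module.finrank ℝ ↥(𝒜 k)) := by
  intro k hk
  rcases le_or_gt k n with hkn | hkn
  · exact even_finrank_of_hasLefschetz_of_le A 𝒜 n hA ω hω hLef k hk hkn
  rcases le_or_gt k (2 * n) with hk2 | hk2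
  · obtain ⟨hmap, hinj⟩ := hLef (2 * n - k) (by omega)
    rw [show 2 * n - (2 * n - k) = k by omega] at hmap
    rw [← hmap, ← LinearMap.range_domRestrict, LinearMap.finrank_range_of_inj]
    · exact even_finrank_of_hasLefschetz_of_le A 𝒜 n hA ω hω hLef (2 * n - k)
        (Nat.Even.sub_odd hk2 (even_two_mul n) hk) (by omega)
    · rw [injective_iff_map_eq_zero]
      exact fun x hx => Subtype.ext (hinj x x.2 hx)
  · rw [hA.vanish k hk2, finrank_bot]
    exact Even.zero
end

section
/- Let M be a real cohomology algebra carrying a Hodge structure, let k be an even integer and l an odd integer, and let M'^k ⊆ M^k and M'^l ⊆ M^l be sub-Hodge structures. Then the rank of the product map μ: M'^l ⊗ M'^k → M^{k+l}, μ(α ⊗ β) = α·β, is even. In particular, taking M'^k = M^k and M'^l = M^l, the product map M^l ⊗ M^k → M^{k+l} has even rank. -/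
open TensorProduct

noncomputable def conjR (V : Type) [AddCommGroup V] [Module ℝ V] :
    ℂ ⊗[ℝ] V →ₗ[ℝ] ℂ ⊗[ℝ] V :=
  LinearMap.rTensor V Complex.conjAe.toLinearMap

structure AlgHodgeStructureR (A : Type) [Ring A] [Algebra ℝ A]
    (𝒜 : ℕ → Submodule ℝ A) where
  H : ℕ → ℤ → Submodule ℂ (ℂ ⊗[ℝ] A)
  indep : ∀ k : ℕ, iSupIndep (H k)
  supEq : ∀ k : ℕ, (⨆ p : ℤ, H k p) = (𝒜 k).baseChange ℂ
  conj_mem : ∀ (k : ℕ) (p : ℤ), ∀ x ∈ H k p, conjR A x ∈ H k (k - p)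
  mul_mem : ∀ (k l : ℕ) (p p' : ℤ), ∀ x ∈ H k p, ∀ y ∈ H l p',
    x * y ∈ H (k + l) (p + p')

/-- `B ⊆ A^k` is a sub-Hodge structure of the weight-`k` Hodge structure. -/
def IsSubHodgeR {A : Type} [Ring A] [Algebra ℝ A] {𝒜 : ℕ → Submodule ℝ A}
    (HS : AlgHodgeStructureR A 𝒜) (k : ℕ) (B : Submodule ℝ A) : Prop :=
  B ≤ 𝒜 k ∧ B.baseChange ℂ = ⨆ p : ℤ, B.baseChange ℂ ⊓ HS.H k p

section ComplexConjugation

variable {V : Type} [AddCommGroup V] [Module ℝ V]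

lemma conjR_smul (z : ℂ) (x : ℂ ⊗[ℝ] V) :
    conjR V (z • x) = starRingEnd ℂ z • conjR V x := by
  induction x with
  | zero => simp
  | add x y hx hy => simp only [smul_add, map_add, hx, hy]
  | tmul a v => simp [conjR, smul_tmul']

lemma conjR_conjR (x : ℂ ⊗[ℝ] V) : conjR V (conjR V x) = x := by
  induction x with
  | zero => simp
  | add x y hx hy => simp only [map_add, hx, hy]
  | tmul a v => simp [conjR]

/-- Complex conjugation as a conjugate-linear map. -/
noncomputable def conjSemilinear (V : Type) [AddCommGroup V] [Module ℝ V] :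
    ℂ ⊗[ℝ] V →ₛₗ[starRingEnd ℂ] ℂ ⊗[ℝ] V where
  toFun := conjR V
  map_add' := map_add _
  map_smul' := conjR_smul

lemma conjR_mem_baseChange (B : Submodule ℝ V) {x : ℂ ⊗[ℝ] V} (hx : x ∈ B.baseChange ℂ) :
    conjR V x ∈ B.baseChange ℂ := by
  suffices B.baseChange ℂ ≤ (B.baseChange ℂ).comap (conjSemilinear V) from this hx
  conv_lhs => rw [Submodule.baseChange_eq_span]
  rw [Submodule.span_le]
  rintro _ ⟨v, hv, rfl⟩
  have h : conjR V (1 ⊗ₜ v) = 1 ⊗ₜ v := by simp [conjR]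
  change conjR V (1 ⊗ₜ v) ∈ B.baseChange ℂ
  rw [h]
  exact Submodule.tmul_mem_baseChange_of_mem 1 hv

lemma finrank_le_of_conjR_mem [FiniteDimensional ℝ V] {U W : Submodule ℂ (ℂ ⊗[ℝ] V)}
    (h : ∀ x ∈ U, conjR V x ∈ W) : Module.finrank ℂ U ≤ Module.finrank ℂ W := by
  have hinj : Function.Injective
      ((conjR V).restrict (p := U.restrictScalars ℝ) (q := W.restrictScalars ℝ) h) := by
    intro x y hxy
    have hxy' : conjR V x = conjR V y := congrArg Subtype.val hxy
    exact Subtype.ext (by rw [← conjR_conjR (x : ℂ ⊗[ℝ] V), hxy', conjR_conjR])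
  have : Module.Finite ℝ W := Module.Finite.trans ℂ W
  have hle : Module.finrank ℝ U ≤ Module.finrank ℝ W :=
    LinearMap.finrank_le_finrank_of_injective hinj
  rw [← Module.finrank_mul_finrank ℝ ℂ U, ← Module.finrank_mul_finrank ℝ ℂ W,
    Complex.finrank_real_complex] at hle
  omega

lemma finrank_complex_baseChange (B : Submodule ℝ V) :
    Module.finrank ℂ (B.baseChange ℂ) = Module.finrank ℝ B := by
  rw [← (Submodule.toBaseChange.toLinearEquiv ℂ B).finrank_eq, Module.finrank_baseChange]

/-- A real Hodge structure of odd weight has even dimension. -/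
lemma even_finrank_of_odd_weight [FiniteDimensional ℝ V] {n : ℤ} (hn : Odd n)
    {H : ℤ → Submodule ℂ (ℂ ⊗[ℝ] V)} (hind : iSupIndep H)
    (hconj : ∀ p, ∀ x ∈ H p, conjR V x ∈ H (n - p)) {B : Submodule ℝ V}
    (hB : B.baseChange ℂ = ⨆ p, B.baseChange ℂ ⊓ H p) :
    Even (Module.finrank ℝ B) := by
  set G : ℤ → Submodule ℂ (ℂ ⊗[ℝ] V) := fun p => B.baseChange ℂ ⊓ H p with hG
  have hGconj : ∀ p, ∀ x ∈ G p, conjR V x ∈ G (n - p) := fun p x hx =>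
    ⟨conjR_mem_baseChange B hx.1, hconj p x hx.2⟩
  have hGind : iSupIndep G := hind.mono fun p => inf_le_right
  have hswap : ∀ s t : Set ℤ, (∀ p ∈ s, n - p ∈ t) →
      Module.finrank ℂ ↥(⨆ p ∈ s, G p) ≤ Module.finrank ℂ ↥(⨆ p ∈ t, G p) := by
    intro s t hst
    apply finrank_le_of_conjR_mem
    suffices (⨆ p ∈ s, G p) ≤ (⨆ p ∈ t, G p).comap (conjSemilinear V) from fun x hx => this hx
    exact iSup₂_le fun p hp x hx => (le_biSup G (hst p hp)) (hGconj p x hx)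
  let s : Set ℤ := {p | 2 * p < n}
  let t : Set ℤ := {p | n < 2 * p}
  have heq := le_antisymm
    (hswap s t fun p (hp : 2 * p < n) => show n < 2 * (n - p) by omega)
    (hswap t s fun p (hp : n < 2 * p) => show 2 * (n - p) < n by omega)
  have hdisj : Disjoint (⨆ p ∈ s, G p) (⨆ p ∈ t, G p) :=
    hGind.disjoint_biSup_biSup <| Set.disjoint_left.2
      fun p (hp : 2 * p < n) (hp' : n < 2 * p) => by omega
  have hsup : (⨆ p ∈ s, G p) ⊔ (⨆ p ∈ t, G p) = B.baseChange ℂ := by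
    rw [← iSup_union, hB]
    refine le_antisymm (iSup₂_le fun p _ => le_iSup G p) (iSup_le fun p => le_biSup G ?_)
    obtain ⟨c, rfl⟩ := hn
    change 2 * p < 2 * c + 1 ∨ 2 * c + 1 < 2 * p
    omega
  have hsum := Submodule.finrank_sup_add_finrank_inf_eq (⨆ p ∈ s, G p) (⨆ p ∈ t, G p)
  rw [hdisj.eq_bot, hsup, finrank_bot, finrank_complex_baseChange, ← heq] at hsum
  exact ⟨_, hsum⟩

end ComplexConjugation

lemma baseChange_mul_eq {A : Type} [Ring A] [Algebra ℝ A] (P N : Submodule ℝ A) :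
    (P * N).baseChange ℂ = P.baseChange ℂ * N.baseChange ℂ := by
  apply le_antisymm
  · rw [Submodule.baseChange_eq_span, Submodule.span_le]
    rintro _ ⟨x, hx, rfl⟩
    change (1 : ℂ) ⊗ₜ[ℝ] x ∈ P.baseChange ℂ * N.baseChange ℂ
    induction hx using Submodule.mul_induction_on' with
    | mem_mul_mem x hx y hy =>
      have h : (1 : ℂ) ⊗ₜ[ℝ] (x * y) = (1 ⊗ₜ[ℝ] x) * (1 ⊗ₜ[ℝ] y) := by simp
      rw [h]
      exact Submodule.mul_mem_mul (Submodule.tmul_mem_baseChange_of_mem 1 hx)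
        (Submodule.tmul_mem_baseChange_of_mem 1 hy)
    | add x _ y _ hx hy =>
      rw [tmul_add]
      exact add_mem hx hy
  · rw [Submodule.baseChange_eq_span ℂ P, Submodule.baseChange_eq_span ℂ N, Submodule.span_mul_span,
      Submodule.span_le]
    rintro _ ⟨_, ⟨p, hp, rfl⟩, _, ⟨n, hn, rfl⟩, rfl⟩
    have hpn : p * n ∈ P * N := Submodule.mul_mem_mul hp hn
    simpa using Submodule.tmul_mem_baseChange_of_mem (1 : ℂ) hpn

/-- The product of two sub-Hodge structures is spanned by its Hodge components. -/
lemma baseChange_mul_eq_iSup {A : Type} [Ring A] [Algebra ℝ A] {𝒜 : ℕ → Submodule ℝ A}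
    (HS : AlgHodgeStructureR A 𝒜) {k l : ℕ} {P N : Submodule ℝ A}
    (hP : IsSubHodgeR HS l P) (hN : IsSubHodgeR HS k N) :
    (P * N).baseChange ℂ = ⨆ p : ℤ, (P * N).baseChange ℂ ⊓ HS.H (l + k) p := by
  refine le_antisymm ?_ (iSup_le fun p => inf_le_left)
  conv_lhs => rw [baseChange_mul_eq, hP.2, hN.2, Submodule.iSup_mul]
  refine iSup_le fun p => ?_
  rw [Submodule.mul_iSup]
  refine iSup_le fun q => le_iSup_of_le (p + q) (le_inf ?_ ?_)
  · rw [baseChange_mul_eq]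
    exact mul_le_mul' inf_le_left inf_le_left
  · exact Submodule.mul_le.2 fun x hx y hy => HS.mul_mem l k p q x hx.2 y hy.2

theorem stmt6 (M : Type) [Ring M] [Algebra ℝ M] (𝕄 : ℕ → Submodule ℝ M)
    [GradedAlgebra 𝕄] (m : ℕ) (hM : IsCohomologyAlgebra ℝ M 𝕄 m)
    (HS : AlgHodgeStructureR M 𝕄)
    (k l : ℕ) (hk : Even k) (hl : Odd l)
    (N P : Submodule ℝ M) (hN : IsSubHodgeR HS k N) (hP : IsSubHodgeR HS l P) :
    Even (Module.finrank ℝ ↥(P * N)) := by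
  have := hM.finite
  have hodd : Odd ((l + k : ℕ) : ℤ) := by exact_mod_cast hl.add_even hk
  exact even_finrank_of_odd_weight hodd (HS.indep (l + k)) (HS.conj_mem (l + k))
    (baseChange_mul_eq_iSup HS hP hN)
end

section
/- Let A and B be real cohomology algebras of dimensions 2s and 2t respectively, let M = A ⊗ B be their graded tensor product (a real cohomology algebra of dimension 2n with n = s+t), and let ω = a ⊗ 1_B + 1_A ⊗ b ∈ M², with a ∈ A² and b ∈ B², satisfy the Lefschetz property on M. Then a satisfies the Lefschetz property on A and b satisfies the Lefschetz property on B: for every 0 ≤ k ≤ s the map α ↦ a^{s−k}·α is an isomorphism from A^k onto A^{2s−k}, and for every 0 ≤ k ≤ t the map β ↦ b^{t−k}·β is an isomorphism from B^k onto B^{2t−k}. -/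
open TensorProduct

section TensorIso

variable (A B M : Type) [Ring A] [Algebra ℝ A] [Ring B] [Algebra ℝ B]
  [Ring M] [Algebra ℝ M]

/-- `φ : A ⊗ B ≃ M` is an isomorphism of graded algebras, where `A ⊗ B` carries the
graded (Koszul sign) tensor product algebra structure. -/
structure IsGradedTensorIso (𝒜 : ℕ → Submodule ℝ A) (ℬ : ℕ → Submodule ℝ B)
    (𝕄 : ℕ → Submodule ℝ M) (φ : (A ⊗[ℝ] B) ≃ₗ[ℝ] M) : Prop where
  map_one : φ ((1 : A) ⊗ₜ[ℝ] (1 : B)) = 1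
  map_grade : ∀ (i j : ℕ), ∀ a ∈ 𝒜 i, ∀ b ∈ ℬ j, φ (a ⊗ₜ[ℝ] b) ∈ 𝕄 (i + j)
  grade_eq : ∀ k : ℕ, 𝕄 k = ⨆ (i : ℕ) (j : ℕ) (_ : i + j = k),
    Submodule.map φ.toLinearMap (Submodule.map₂ (TensorProduct.mk ℝ A B) (𝒜 i) (ℬ j))
  map_mul : ∀ (i j i' j' : ℕ), ∀ a ∈ 𝒜 i, ∀ b ∈ ℬ j, ∀ a' ∈ 𝒜 i', ∀ b' ∈ ℬ j',
    φ (a ⊗ₜ[ℝ] b) * φ (a' ⊗ₜ[ℝ] b') =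
      ((-1 : ℝ) ^ (j * i')) • φ ((a * a') ⊗ₜ[ℝ] (b * b'))

end TensorIso

namespace IsCohomologyAlgebra

variable {F : Type} [Field F] {A : Type} [Ring A] [Algebra F A]
  {𝒜 : ℕ → Submodule F A} [GradedAlgebra 𝒜]

theorem finrank_le_finrank_compl {m : ℕ} (hA : IsCohomologyAlgebra F A 𝒜 m) {k : ℕ}
    (hk : k ≤ m) : Module.finrank F (𝒜 k) ≤ Module.finrank F (𝒜 (m - k)) := by
  have := hA.finite
  have hmem (x : 𝒜 k) (y : 𝒜 (m - k)) : (x : A) * y ∈ 𝒜 m := by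
    simpa [Nat.add_sub_cancel' hk] using SetLike.mul_mem_graded x.2 y.2
  let g : 𝒜 k →ₗ[F] 𝒜 (m - k) →ₗ[F] 𝒜 m :=
    LinearMap.mk₂ F (fun x y => ⟨(x : A) * y, hmem x y⟩)
      (fun x x' y => Subtype.ext (by simp [add_mul]))
      (fun c x y => Subtype.ext (by simp))
      (fun x y y' => Subtype.ext (by simp [mul_add]))
      (fun c x y => Subtype.ext (by simp))
  have hg : Function.Injective g := by
    rw [injective_iff_map_eq_zero]
    intro x hx
    by_contra hne
    obtain ⟨y, hy, hxy⟩ := hA.nondeg k hk x x.2 (by simpa using hne)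
    exact hxy (congrArg Subtype.val (LinearMap.congr_fun hx ⟨y, hy⟩))
  simpa [Module.finrank_linearMap, hA.topRank] using LinearMap.finrank_le_finrank_of_injective hg

theorem one_ne_zero {m : ℕ} (hA : IsCohomologyAlgebra F A 𝒜 m) : (1 : A) ≠ 0 := by
  intro h
  have := subsingleton_of_zero_eq_one h.symm
  have h1 := hA.topRank
  rw [Module.finrank_zero_of_subsingleton] at h1
  exact zero_ne_one h1

theorem pow_mem {a : A} (ha : a ∈ 𝒜 2) (i : ℕ) : a ^ i ∈ 𝒜 (2 * i) := by
  simpa [mul_comm] using SetLike.pow_mem_graded i ha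

theorem pow_eq_zero {n : ℕ} (hA : IsCohomologyAlgebra F A 𝒜 (2 * n)) {a : A} (ha : a ∈ 𝒜 2) :
    a ^ (n + 1) = 0 := by
  have h := pow_mem ha (n + 1)
  rwa [hA.vanish _ (by omega), Submodule.mem_bot] at h

/-- By Poincaré duality, injectivity of the Lefschetz maps suffices. -/
theorem hasLefschetz_of_injective {n : ℕ} (hA : IsCohomologyAlgebra F A 𝒜 (2 * n)) {a : A}
    (ha : a ∈ 𝒜 2) (h : ∀ k, k ≤ n → ∀ x ∈ 𝒜 k, a ^ (n - k) * x = 0 → x = 0) :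
    HasLefschetz F A 𝒜 n a := by
  have := hA.finite
  refine fun k hk => ⟨Submodule.eq_of_le_of_finrank_le ?_ ?_, h k hk⟩
  · rintro _ ⟨x, hx, rfl⟩
    have := SetLike.mul_mem_graded (pow_mem ha (n - k)) hx
    rwa [show 2 * (n - k) + k = 2 * n - k by omega] at this
  · have hle := hA.finrank_le_finrank_compl (k := 2 * n - k) (by omega)
    rw [show 2 * n - (2 * n - k) = k by omega] at hle
    refine hle.trans (le_of_eq ?_)
    rw [← LinearMap.range_domRestrict]
    refine (LinearMap.finrank_range_of_inj ?_).symm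
    rw [injective_iff_map_eq_zero]
    intro x hx
    exact Subtype.ext (h k hk x x.2 hx)

end IsCohomologyAlgebra

namespace IsGradedTensorIso

open IsCohomologyAlgebra

variable {A B M : Type} [Ring A] [Algebra ℝ A] [Ring B] [Algebra ℝ B] [Ring M] [Algebra ℝ M]
  {𝒜 : ℕ → Submodule ℝ A} {ℬ : ℕ → Submodule ℝ B} {𝕄 : ℕ → Submodule ℝ M}
  [GradedAlgebra 𝒜] [GradedAlgebra ℬ] {φ : (A ⊗[ℝ] B) ≃ₗ[ℝ] M}

theorem add_pow_mul_tmul (hφ : IsGradedTensorIso A B M 𝒜 ℬ 𝕄 φ) {a : A} (ha : a ∈ 𝒜 2)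
    {b : B} (hb : b ∈ ℬ 2) {k l : ℕ} {x : A} (hx : x ∈ 𝒜 k) {y : B} (hy : y ∈ ℬ l) (N : ℕ) :
    (φ (a ⊗ₜ[ℝ] 1) + φ (1 ⊗ₜ[ℝ] b)) ^ N * φ (x ⊗ₜ[ℝ] y) =
      ∑ p ∈ Finset.HasAntidiagonal.antidiagonal N, N.choose p.1 • φ ((a ^ p.1 * x) ⊗ₜ[ℝ] (b ^ p.2 * y)) := by
  have h1A : (1 : A) ∈ 𝒜 0 := SetLike.one_mem_graded 𝒜
  have h1B : (1 : B) ∈ ℬ 0 := SetLike.one_mem_graded ℬ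
  have hcomm : Commute (φ (a ⊗ₜ[ℝ] 1)) (φ (1 ⊗ₜ[ℝ] b)) := by
    rw [Commute, SemiconjBy, hφ.map_mul 2 0 0 2 a ha 1 h1B 1 h1A b hb,
      hφ.map_mul 0 2 2 0 1 h1A b hb a ha 1 h1B]
    simp [Even.neg_one_pow (show Even 4 by decide)]
  have hP (i : ℕ) {k l : ℕ} {x : A} (hx : x ∈ 𝒜 k) {y : B} (hy : y ∈ ℬ l) :
      φ (a ⊗ₜ[ℝ] 1) ^ i * φ (x ⊗ₜ[ℝ] y) = φ ((a ^ i * x) ⊗ₜ[ℝ] y) := by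
    induction i with
    | zero => simp
    | succ i ih =>
      rw [pow_succ', mul_assoc, ih, hφ.map_mul 2 0 _ l a ha 1 h1B _
        (SetLike.mul_mem_graded (pow_mem ha i) hx) y hy]
      simp [pow_succ', mul_assoc]
  have hQ (j : ℕ) {k l : ℕ} {x : A} (hx : x ∈ 𝒜 k) {y : B} (hy : y ∈ ℬ l) :
      φ (1 ⊗ₜ[ℝ] b) ^ j * φ (x ⊗ₜ[ℝ] y) = φ (x ⊗ₜ[ℝ] (b ^ j * y)) := by
    induction j with
    | zero => simp
    | succ j ih =>
      rw [pow_succ', mul_assoc, ih, hφ.map_mul 0 2 k _ 1 h1A b hb x hx _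
        (SetLike.mul_mem_graded (pow_mem hb j) hy)]
      simp [pow_succ', mul_assoc, pow_mul]
  rw [hcomm.add_pow', Finset.sum_mul]
  refine Finset.sum_congr rfl fun p _ => ?_
  rw [smul_mul_assoc, mul_assoc, hQ p.2 hx hy,
    hP p.1 hx (SetLike.mul_mem_graded (pow_mem hb p.2) hy)]

theorem add_pow_mul_tmul_eq_zero (hφ : IsGradedTensorIso A B M 𝒜 ℬ 𝕄 φ) {a : A} (ha : a ∈ 𝒜 2)
    {b : B} (hb : b ∈ ℬ 2) {k l : ℕ} {x : A} (hx : x ∈ 𝒜 k) {y : B} (hy : y ∈ ℬ l) {i j N : ℕ}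
    (hax : a ^ i * x = 0) (hby : b ^ j * y = 0) (hN : i + j ≤ N + 1) :
    (φ (a ⊗ₜ[ℝ] 1) + φ (1 ⊗ₜ[ℝ] b)) ^ N * φ (x ⊗ₜ[ℝ] y) = 0 := by
  rw [hφ.add_pow_mul_tmul ha hb hx hy]
  refine Finset.sum_eq_zero fun p hp => ?_
  rw [Finset.HasAntidiagonal.mem_antidiagonal] at hp
  rcases le_or_gt i p.1 with h | h
  · rw [← Nat.sub_add_cancel h, pow_add, mul_assoc, hax]
    simp
  · rw [← Nat.sub_add_cancel (show j ≤ p.2 by omega), pow_add, mul_assoc, hby]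
    simp

end IsGradedTensorIso

theorem stmt11 (A B M : Type) [Ring A] [Algebra ℝ A] [Ring B] [Algebra ℝ B]
    [Ring M] [Algebra ℝ M]
    (𝒜 : ℕ → Submodule ℝ A) (ℬ : ℕ → Submodule ℝ B) (𝕄 : ℕ → Submodule ℝ M)
    [GradedAlgebra 𝒜] [GradedAlgebra ℬ] [GradedAlgebra 𝕄]
    (s t : ℕ) (hA : IsCohomologyAlgebra ℝ A 𝒜 (2 * s))
    (hB : IsCohomologyAlgebra ℝ B ℬ (2 * t))
    (hM : IsCohomologyAlgebra ℝ M 𝕄 (2 * (s + t)))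
    (φ : (A ⊗[ℝ] B) ≃ₗ[ℝ] M) (hφ : IsGradedTensorIso A B M 𝒜 ℬ 𝕄 φ)
    (a : A) (ha : a ∈ 𝒜 2) (b : B) (hb : b ∈ ℬ 2)
    (hLefM : HasLefschetz ℝ M 𝕄 (s + t) (φ (a ⊗ₜ[ℝ] 1) + φ (1 ⊗ₜ[ℝ] b))) :
    HasLefschetz ℝ A 𝒜 s a ∧ HasLefschetz ℝ B ℬ t b := by
  have h1A : (1 : A) ∈ 𝒜 0 := SetLike.one_mem_graded 𝒜
  have h1B : (1 : B) ∈ ℬ 0 := SetLike.one_mem_graded ℬ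
  constructor
  · refine hA.hasLefschetz_of_injective ha fun k hk x hx h => ?_
    have h0 := (hLefM k (by omega)).2 _ (hφ.map_grade k 0 x hx 1 h1B)
      (hφ.add_pow_mul_tmul_eq_zero ha hb hx h1B h (j := t + 1)
        (by rw [hB.pow_eq_zero hb, zero_mul]) (by omega))
    have : Nontrivial B := ⟨1, 0, hB.one_ne_zero⟩
    exact (map_eq_zero_iff _ (Algebra.TensorProduct.includeLeft_injective (S := ℝ) (A := A)
      (FaithfulSMul.algebraMap_injective ℝ B))).1 ((LinearEquiv.map_eq_zero_iff φ).1 h0)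
  · refine hB.hasLefschetz_of_injective hb fun k hk y hy h => ?_
    have hmem := hφ.map_grade 0 k 1 h1A y hy
    rw [zero_add] at hmem
    have h0 := (hLefM k (by omega)).2 _ hmem
      (hφ.add_pow_mul_tmul_eq_zero ha hb h1A hy (i := s + 1)
        (by rw [hA.pow_eq_zero ha, zero_mul]) h (by omega))
    have : Nontrivial A := ⟨1, 0, hA.one_ne_zero⟩
    exact (map_eq_zero_iff _ (Algebra.TensorProduct.includeRight_injective (B := B)
      (FaithfulSMul.algebraMap_injective ℝ A))).1 ((LinearEquiv.map_eq_zero_iff φ).1 h0)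
end

section
/- Let M be a rational cohomology algebra of even dimension 2n that is generated as an algebra by M¹ ∪ M². Then there exists ω ∈ M² with ω^n ≠ 0 in M^{2n}. -/
open TensorProduct

/-- A polynomial function on an infinite field with coefficients in a vector space vanishes
identically only if all its coefficients vanish. -/
theorem eq_zero_of_forall_sum_pow_smul_eq_zero {F E : Type*} [Field F] [Infinite F]
    [AddCommGroup E] [Module F E] (N : ℕ) (c : ℕ → E)
    (h : ∀ t : F, ∑ i ∈ Finset.range N, t ^ i • c i = 0) {i : ℕ} (hi : i < N) : c i = 0 := by
  rw [← Module.forall_dual_apply_eq_zero_iff F]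
  intro f
  have hp : (∑ i ∈ Finset.range N, Polynomial.monomial i (f (c i))) = 0 := by
    refine Polynomial.funext fun t => ?_
    simpa [Polynomial.eval_finsetSum, mul_comm] using congrArg f (h t)
  have hc := congrArg (fun p => Polynomial.coeff p i) hp
  simpa [Polynomial.finsetSum_coeff, Polynomial.coeff_monomial, hi] using hc

/-- Polarization: in characteristic zero, if all `n`-th powers of elements of a subspace of
commuting elements vanish, then so do all products of `n` elements of it. -/
theorem Submodule.pow_mul_eq_zero_of_forall_pow_eq_zero {F A : Type*} [Field F] [CharZero F]
    [Ring A] [Algebra F A] (V : Submodule F A) (hV : ∀ x ∈ V, ∀ y ∈ V, Commute x y) {n : ℕ}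
    (h : ∀ x ∈ V, x ^ n = 0) (j k : ℕ) (hjk : k + j = n) (w : A) (hw : w ∈ V)
    (x : A) (hx : x ∈ V ^ j) : w ^ k * x = 0 := by
  induction j generalizing k w x with
  | zero =>
    obtain rfl : k = n := by omega
    rw [h w hw, zero_mul]
  | succ j ih =>
    rw [pow_succ'] at hx
    induction hx using Submodule.mul_induction_on' with
    | add a _ b _ ha hb => rw [mul_add, ha, hb, add_zero]
    | mem_mul_mem v hv x hx =>
      have hpoly : ∀ t : F, ∑ i ∈ Finset.range (k + 2),
          t ^ i • (v ^ i * w ^ (k + 1 - i) * ((k + 1).choose i : A) * x) = 0 := by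
        intro t
        have h0 := ih (k + 1) (by omega) (t • v + w) (V.add_mem (V.smul_mem t hv) hw) x hx
        rw [((hV v hv w hw).smul_left t).add_pow, Finset.sum_mul] at h0
        simpa [smul_pow] using h0
      have h1 := eq_zero_of_forall_sum_pow_smul_eq_zero _ _ hpoly (i := 1) (by omega)
      have h2 : ((k + 1 : ℕ) : F) • (w ^ k * (v * x)) = 0 := by
        rw [← h1, ← mul_assoc, ← ((hV v hv w hw).pow_right k).eq, Nat.cast_smul_eq_nsmul,
          nsmul_eq_mul, ← mul_assoc]
        simpa using congrArg (· * x) (Nat.cast_commute (k + 1) (v * w ^ k)).eq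
      exact (smul_eq_zero.mp h2).resolve_left (by exact_mod_cast k.succ_ne_zero)

/-- In a graded algebra generated in degrees one and two, in which these degrees commute, every
element of even degree `2 * n` is a sum of products of `n` elements of degree two. -/
theorem GradedAlgebra.le_pow_of_adjoin_eq_top {F A : Type*} [Field F] [Ring A] [Algebra F A]
    (𝒜 : ℕ → Submodule F A) [GradedAlgebra 𝒜]
    (hcomm : ∀ x ∈ 𝒜 2, ∀ y ∈ 𝒜 1, Commute x y)
    (hgen : Algebra.adjoin F ((𝒜 1 : Set A) ∪ (𝒜 2 : Set A)) = ⊤) (n : ℕ) :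
    𝒜 (2 * n) ≤ 𝒜 2 ^ n := by
  let S : ℕ → Submodule F A := fun k => 𝒜 1 ^ (k % 2) * 𝒜 2 ^ (k / 2)
  have hS1 : ∀ g ∈ 𝒜 1, ∀ k, ∀ x ∈ S k, g * x ∈ S (k + 1) := by
    intro g hg k x hx
    obtain ⟨m, rfl | rfl⟩ := k.even_or_odd'
    · have e1 : (2 * m + 1) / 2 = m := by omega
      have e2 : (2 * m + 1) % 2 = 1 := by omega
      simp only [S, e1, e2, pow_one]
      exact Submodule.mul_mem_mul hg (by simpa [S] using hx)
    · have e1 : (2 * m + 1) / 2 = m := by omega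
      have e2 : (2 * m + 1) % 2 = 1 := by omega
      have e3 : (2 * m + 1 + 1) / 2 = m + 1 := by omega
      have e4 : (2 * m + 1 + 1) % 2 = 0 := by omega
      simp only [S, e1, e2, e3, e4, pow_one, pow_zero, one_mul] at hx ⊢
      rw [pow_succ']
      induction hx using Submodule.mul_induction_on' with
      | add a _ b _ ha hb => rw [mul_add]; exact Submodule.add_mem _ ha hb
      | mem_mul_mem v hv x hx =>
        rw [← mul_assoc]
        exact Submodule.mul_mem_mul (SetLike.mul_mem_graded (A := 𝒜) hg hv) hx
  have hS2 : ∀ g ∈ 𝒜 2, ∀ k, ∀ x ∈ S k, g * x ∈ S (k + 2) := by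
    intro g hg k x hx
    have e1 : (k + 2) / 2 = k / 2 + 1 := by omega
    have e2 : (k + 2) % 2 = k % 2 := by omega
    simp only [S, e1, e2] at hx ⊢
    obtain h | h := Nat.mod_two_eq_zero_or_one k
    · simp only [h, pow_zero, one_mul] at hx ⊢
      rw [pow_succ']
      exact Submodule.mul_mem_mul hg hx
    · simp only [h, pow_one] at hx ⊢
      induction hx using Submodule.mul_induction_on' with
      | add a _ b _ ha hb => rw [mul_add]; exact Submodule.add_mem _ ha hb
      | mem_mul_mem v hv x hx =>
        rw [pow_succ', ← mul_assoc g, (hcomm g hg v hv).eq, mul_assoc v]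
        exact Submodule.mul_mem_mul hv (Submodule.mul_mem_mul hg hx)
  let P : A → Prop := fun x => ∀ k, (DirectSum.decompose 𝒜 x k : A) ∈ S k
  have hstep : ∀ d, (∀ g ∈ 𝒜 d, ∀ k, ∀ x ∈ S k, g * x ∈ S (k + d)) →
      ∀ g ∈ 𝒜 d, ∀ x, P x → P (g * x) := by
    intro d hd g hg x hx k
    by_cases hk : d ≤ k
    · rw [DirectSum.coe_decompose_mul_of_left_mem_of_le 𝒜 hg hk]
      simpa [Nat.sub_add_cancel hk] using hd g hg _ _ (hx (k - d))
    · rw [DirectSum.coe_decompose_mul_of_left_mem_of_not_le 𝒜 hg hk]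
      exact Submodule.zero_mem _
  have hadd : ∀ x y, P x → P y → P (x + y) := by
    intro x y hx hy k
    simpa [DirectSum.decompose_add] using Submodule.add_mem _ (hx k) (hy k)
  have hmul : ∀ a ∈ Algebra.adjoin F ((𝒜 1 : Set A) ∪ (𝒜 2 : Set A)),
      ∀ x, P x → P (a * x) := by
    intro a ha
    induction ha using Algebra.adjoin_induction with
    | mem g hg => exact hg.elim (hstep 1 hS1 g) (hstep 2 hS2 g)
    | algebraMap r =>
      intro x hx k
      rw [← Algebra.smul_def]
      rw [DirectSum.decompose_smul]
      exact Submodule.smul_mem _ r (hx k)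
    | add a b _ _ ha hb =>
      intro x hx
      rw [add_mul]
      exact hadd _ _ (ha x hx) (hb x hx)
    | mul a b _ _ ha hb =>
      intro x hx
      rw [mul_assoc]
      exact ha _ (hb x hx)
  have hone : P 1 := by
    intro k
    have h1 : (1 : A) ∈ 𝒜 0 := SetLike.GradedOne.one_mem
    by_cases hk : 0 = k
    · subst hk
      rw [DirectSum.decompose_of_mem_same 𝒜 h1]
      simp [S, Submodule.one_le.mp le_rfl]
    · rw [DirectSum.decompose_of_mem_ne 𝒜 h1 hk]
      exact Submodule.zero_mem _
  intro x hx
  have hxP := hmul x (hgen ▸ Algebra.mem_top) 1 hone (2 * n)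
  rw [mul_one, DirectSum.decompose_of_mem_same 𝒜 hx] at hxP
  simpa [S] using hxP

theorem stmt14 (M : Type) [Ring M] [Algebra ℚ M] (𝕄 : ℕ → Submodule ℚ M)
    [GradedAlgebra 𝕄] (n : ℕ) (hM : IsCohomologyAlgebra ℚ M 𝕄 (2 * n))
    (hgen : Algebra.adjoin ℚ ((𝕄 1 : Set M) ∪ (𝕄 2 : Set M)) = ⊤) :
    ∃ ω ∈ 𝕄 2, ω ^ n ≠ 0 := by
  by_contra! h
  have hcomm : ∀ l, ∀ x ∈ 𝕄 2, ∀ y ∈ 𝕄 l, Commute x y := by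
    intro l x hx y hy
    simpa [pow_mul, Commute, SemiconjBy] using hM.gcomm 2 l x y hx hy
  have hbot : 𝕄 (2 * n) = ⊥ := by
    refine (Submodule.eq_bot_iff _).mpr fun x hx => ?_
    simpa using Submodule.pow_mul_eq_zero_of_forall_pow_eq_zero (𝕄 2) (hcomm 2) h n 0
      (zero_add n) 0 (Submodule.zero_mem _) x
      (GradedAlgebra.le_pow_of_adjoin_eq_top 𝕄 (hcomm 1) hgen n hx)
  have htop := hM.topRank
  rw [hbot, finrank_bot] at htop
  exact zero_ne_one htop
end

section
/- Let n, q, q' be positive integers with q = 2q' or q = 2q'+1, satisfying q' ≤ n(n−1)/2 and (q−q')·(n(n−1)/2 − q') > n². Let M be a real vector space of dimension 2n and Q a real vector space of dimension q. Then there exists a surjective linear map μ: Λ²M → Q such that there is no complex vector subspace W ⊆ M_ℂ := M ⊗ ℂ with dim_ℂ W = n and rank(μ_ℂ|_{Λ²W}) ≤ q'. -/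
open TensorProduct

theorem exists_algebraicIndependent_real (ι : Type) [Finite ι] :
    ∃ r : ι → ℝ, AlgebraicIndependent ℚ r := by
  obtain ⟨s, hs⟩ := exists_isTranscendenceBasis ℚ ℝ
  have hinf : Infinite s := by
    by_contra h
    rw [not_infinite_iff_finite] at h
    have : Algebra.IsAlgebraic (Algebra.adjoin ℚ (Set.range ((↑) : s → ℝ))) ℝ := hs.isAlgebraic
    have h1 := Algebra.IsAlgebraic.cardinalMk_le_max
      (Algebra.adjoin ℚ (Set.range ((↑) : s → ℝ))) ℝ
    have h2 : Cardinal.mk (Algebra.adjoin ℚ (Set.range ((↑) : s → ℝ))) ≤ Cardinal.aleph0 := by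
      rw [← Cardinal.mk_congr hs.1.aevalEquiv.toEquiv]
      exact MvPolynomial.cardinalMk_le_max.trans (by simp)
    rw [max_eq_right h2, Cardinal.mk_real] at h1
    exact absurd h1 (not_le.2 Cardinal.aleph0_lt_continuum)
  have := Fintype.ofFinite ι
  obtain ⟨f⟩ : Nonempty (ι ↪ s) := ⟨(Fintype.equivFin ι).toEmbedding.trans
    (Fin.valEmbedding.trans (Infinite.natEmbedding s))⟩
  exact ⟨_, hs.1.comp f f.injective⟩

theorem AlgebraicIndependent.card_le_of_mem_adjoin {R A ι : Type} [CommRing R] [IsDomain R]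
    [CommRing A] [Algebra R A] {r : ι → A} (hr : AlgebraicIndependent R r)
    {U : Finset ι} {X : Finset A} (h : ∀ i ∈ U, r i ∈ Algebra.adjoin R (X : Set A)) :
    U.card ≤ X.card := by
  let B := Algebra.adjoin R (X : Set A)
  let g : U → B := fun i => ⟨r i, h i i.2⟩
  have hg : AlgebraicIndependent R g :=
    AlgebraicIndependent.of_comp B.val (by exact hr.comp _ Subtype.val_injective)
  let φ : MvPolynomial X R →ₐ[R] B :=
    MvPolynomial.aeval fun x => ⟨x, Algebra.subset_adjoin x.2⟩
  have hφ : Function.Surjective φ := by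
    rw [← AlgHom.range_eq_top, ← Algebra.adjoin_range_eq_range_aeval, ← top_le_iff]
    rw [← Algebra.adjoin_adjoin_coe_preimage (R := R) (s := (X : Set A))]
    refine Algebra.adjoin_mono ?_
    intro y hy
    exact ⟨⟨y, hy⟩, rfl⟩
  have h1 := hg.cardinalMk_le_trdeg.trans (trdeg_le_of_surjective φ hφ)
  rw [MvPolynomial.trdeg_of_isDomain] at h1
  simpa using h1

theorem Submodule.exists_graph_coordinates {K V ι : Type*} [Field K] [AddCommGroup V] [Module K V]
    [Fintype ι] [DecidableEq ι] (b : Module.Basis ι K V) (W : Submodule K V) :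
    ∃ (S : Finset ι) (a : ι → ι → K), S.card = Module.finrank K W ∧
      (∀ i, b i - ∑ j ∈ Sᶜ, a i j • b j ∈ W) ∧
      ∀ v ∈ W, ∀ j ∉ S, b.repr v j = - ∑ i ∈ S, b.repr v i * a i j := by
  classical
  have := Module.Finite.of_basis b
  obtain ⟨T, -, -, hT, hli⟩ := exists_linearIndepOn_extension
    (linearIndepOn_empty K (fun i => W.mkQ (b i))) (Set.empty_subset Set.univ)
  obtain ⟨S, rfl⟩ : ∃ S : Finset ι, T = ↑(Sᶜ) := ⟨T.toFinsetᶜ, by simp⟩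
  have hex : ∀ i, ∃ a : ι → K, ∑ j ∈ Sᶜ, a j • W.mkQ (b j) = W.mkQ (b i) := fun i =>
    (Submodule.mem_span_image_finset_iff_exists_fun' K).1 (hT ⟨i, trivial, rfl⟩)
  choose a ha using hex
  have hW : ∀ i, b i - ∑ j ∈ Sᶜ, a i j • b j ∈ W := fun i => by
    rw [← Submodule.ker_mkQ W, LinearMap.mem_ker, map_sub, map_sum, sub_eq_zero, ← ha i]
    simp
  refine ⟨S, a, ?_, hW, ?_⟩
  · have hspan : ⊤ ≤ Submodule.span K (Set.range fun i : (↑(Sᶜ) : Set ι) => W.mkQ (b i)) := by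
      rw [← Set.image_eq_range (fun i => W.mkQ (b i)), ← Submodule.range_mkQ W,
        LinearMap.range_eq_map, ← b.span_eq, Submodule.map_span, Submodule.span_le,
        ← Set.range_comp, ← Set.image_univ]
      exact hT
    have h1 := Module.finrank_eq_card_basis (Module.Basis.mk hli hspan)
    have h2 := W.finrank_quotient_add_finrank
    have h3 := Module.finrank_eq_card_basis b
    have h4 := S.card_compl_add_card
    simp only [Finset.coe_sort_coe, Fintype.card_coe] at h1
    omega
  · intro v hv
    have key : ∑ j ∈ Sᶜ, (b.repr v j + ∑ i ∈ S, b.repr v i * a i j) • W.mkQ (b j) = 0 := by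
      have h0 : W.mkQ v = 0 := by simpa using hv
      conv_lhs at h0 => rw [← b.sum_repr v, map_sum, ← Finset.sum_compl_add_sum S]
      rw [← h0]
      simp only [add_smul, Finset.sum_add_distrib, map_smul]
      congr 1
      simp only [Finset.sum_smul]
      rw [Finset.sum_comm]
      refine Finset.sum_congr rfl fun i _ => ?_
      rw [← ha i, Finset.smul_sum]
      simp only [smul_smul]
    intro j hj
    have := (linearIndepOn_finset_iff.1 hli) _ key j (by simpa using hj)
    exact eq_neg_of_add_eq_zero_left this

theorem Finset.card_filter_lt_product {α : Type*} [LinearOrder α] (S : Finset α) :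
    ((S ×ˢ S).filter fun p => p.1 < p.2).card = S.card * (S.card - 1) / 2 := by
  have h1 : ((S ×ˢ S).filter fun p => p.2 < p.1).card =
      ((S ×ˢ S).filter fun p => p.1 < p.2).card :=
    Finset.card_equiv (Equiv.prodComm α α) (by simp [and_comm])
  have h2 : S.offDiag = ((S ×ˢ S).filter fun p => p.1 < p.2) ∪
      ((S ×ˢ S).filter fun p => p.2 < p.1) := by
    ext p; simp; grind
  have h3 := S.offDiag_card
  rw [h2, Finset.card_union_of_disjoint, h1] at h3
  · rw [Nat.mul_sub, mul_one, ← h3]; omega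
  · rw [Finset.disjoint_left]; intro p; simp only [mem_filter]; rintro ⟨-, h⟩ ⟨-, h'⟩
    exact lt_asymm h h'

theorem finrank_span_image_of_algebraicIndependent {R K ι κ : Type} {V P : Type*} [CommRing R] [IsDomain R]
    [Field K] [Algebra R K] [AddCommGroup V] [Module K V] [AddCommGroup P] [Module K P]
    [Fintype ι] [LinearOrder ι] [Fintype κ] [DecidableEq κ]
    (b : Module.Basis ι K V) (c : Module.Basis κ K P) (B : V →ₗ[K] V →ₗ[K] P)
    (hB : ∀ i j, B (b i) (b j) = -B (b j) (b i)) (hB' : ∀ i, B (b i) (b i) = 0)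
    {ρ : ι × ι × κ → K} (hρ : AlgebraicIndependent R ρ)
    (hBρ : ∀ i j, i < j → ∀ l, c.repr (B (b i) (b j)) l = ρ (i, j, l))
    (W : Submodule K V) {n r : ℕ} (hn : Module.finrank K W = n)
    (hr : Module.finrank K (Submodule.span K {z | ∃ x ∈ W, ∃ y ∈ W, B x y = z}) = r) :
    (Fintype.card κ - r) * (n * (n - 1) / 2 - r) ≤ n * (Fintype.card ι - n) := by
  classical
  obtain ⟨S, a, hS, haW, -⟩ := W.exists_graph_coordinates b
  obtain ⟨S', a', hS', -, ha'⟩ :=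
    (Submodule.span K {z | ∃ x ∈ W, ∃ y ∈ W, B x y = z}).exists_graph_coordinates c
  rw [hn] at hS
  rw [hr] at hS'
  let w : ι → V := fun i => b i - ∑ j ∈ Sᶜ, a i j • b j
  let D : Finset (ι × ι) := (Finset.univ ×ˢ Finset.univ).filter fun p => p.1 < p.2
  let E : Finset (ι × ι) := (S ×ˢ S).filter fun p => p.1 < p.2
  have hED : E ⊆ D := fun p => by simp +contextual [E, D]
  let X₁ : Finset K := (S ×ˢ Sᶜ).image fun p => a p.1 p.2
  let X₂ : Finset K := (S' ×ˢ S'ᶜ).image fun p => a' p.1 p.2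
  let X₃ : Finset K := (E ×ˢ S').image fun p => c.repr (B (w p.1.1) (w p.1.2)) p.2
  let X₄ : Finset K := ((D \ E) ×ˢ Finset.univ).image fun p => ρ (p.1.1, p.1.2, p.2)
  let X : Finset K := X₁ ∪ X₂ ∪ X₃ ∪ X₄
  let A := Algebra.adjoin R (X : Set K)
  have hXA : ∀ x ∈ X, x ∈ A := fun x hx => Algebra.subset_adjoin hx
  have hA₁ : ∀ i ∈ S, ∀ j ∈ Sᶜ, a i j ∈ A := fun i hi j hj => hXA _ <| by
    simp only [X, Finset.mem_union]
    exact .inl <| .inl <| .inl <| Finset.mem_image.2 ⟨(i, j), Finset.mk_mem_product hi hj, rfl⟩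
  have hA₂ : ∀ i ∈ S', ∀ j ∈ S'ᶜ, a' i j ∈ A := fun i hi j hj => hXA _ <| by
    simp only [X, Finset.mem_union]
    exact .inl <| .inl <| .inr <| Finset.mem_image.2 ⟨(i, j), Finset.mk_mem_product hi hj, rfl⟩
  have hA₃ : ∀ p ∈ E, ∀ l ∈ S', c.repr (B (w p.1) (w p.2)) l ∈ A := fun p hp l hl => hXA _ <| by
    simp only [X, Finset.mem_union]
    exact .inl <| .inr <| Finset.mem_image.2 ⟨(p, l), Finset.mk_mem_product hp hl, rfl⟩
  have hA₄ : ∀ p ∈ D \ E, ∀ l, ρ (p.1, p.2, l) ∈ A := fun p hp l => hXA _ <| by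
    simp only [X, Finset.mem_union]
    exact .inr <| Finset.mem_image.2
      ⟨(p, l), Finset.mk_mem_product hp (Finset.mem_univ l), rfl⟩
  have hlt : ∀ i j, i < j → ¬ (i ∈ S ∧ j ∈ S) → ∀ l, c.repr (B (b i) (b j)) l ∈ A := by
    intro i j hij hS l
    rw [hBρ i j hij]
    refine hA₄ (i, j) ?_ l
    simp only [Finset.mem_sdiff, D, E, Finset.mem_filter, Finset.mem_product]
    exact ⟨⟨⟨Finset.mem_univ _, Finset.mem_univ _⟩, hij⟩, fun h => hS h.1⟩
  have hout : ∀ i j, ¬ (i ∈ S ∧ j ∈ S) → ∀ l, c.repr (B (b i) (b j)) l ∈ A := by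
    intro i j hS l
    rcases lt_trichotomy i j with h | rfl | h
    · exact hlt i j h hS l
    · simp [hB']
    · rw [hB i j, map_neg, Finsupp.neg_apply]
      exact neg_mem (hlt j i h (fun h => hS h.symm) l)
  have hwA : ∀ p ∈ E, ∀ l, c.repr (B (w p.1) (w p.2)) l ∈ A := by
    intro p hp l
    by_cases hl : l ∈ S'
    · exact hA₃ p hp l hl
    · rw [ha' _ (Submodule.subset_span ⟨_, haW p.1, _, haW p.2, rfl⟩) l hl]
      exact neg_mem (sum_mem fun i hi => mul_mem (hA₃ p hp i hi)
        (hA₂ i hi l (Finset.mem_compl.2 hl)))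
  have hmem : ∀ t ∈ D ×ˢ (Finset.univ : Finset κ), ρ (t.1.1, t.1.2, t.2) ∈ A := by
    rintro ⟨⟨i, j⟩, l⟩ ht
    have hij : (i, j) ∈ D := (Finset.mem_product.1 ht).1
    by_cases hE : (i, j) ∈ E
    swap
    · exact hA₄ (i, j) (Finset.mem_sdiff.2 ⟨hij, hE⟩) l
    have hi : i ∈ S := by simp [E] at hE; exact hE.1.1
    have hj : j ∈ S := by simp [E] at hE; exact hE.1.2
    rw [← hBρ i j (Finset.mem_filter.1 hij).2]
    have key : c.repr (B (b i) (b j)) l = c.repr (B (w i) (w j)) l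
        + ∑ k ∈ Sᶜ, a i k * c.repr (B (b k) (b j)) l
        + ∑ k ∈ Sᶜ, a j k * (c.repr (B (b i) (b k)) l
          - ∑ k' ∈ Sᶜ, a i k' * c.repr (B (b k') (b k)) l) := by
      simp only [w, map_sub, map_sum, map_smul, LinearMap.sub_apply, LinearMap.sum_apply,
        LinearMap.smul_apply, Finsupp.sub_apply, Finsupp.finsetSum_apply, Finsupp.smul_apply,
        smul_eq_mul]
      ring
    rw [key]
    refine add_mem (add_mem (hwA _ hE l) (sum_mem fun k hk => mul_mem (hA₁ i hi k hk) ?_))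
      (sum_mem fun k hk => mul_mem (hA₁ j hj k hk) (sub_mem ?_
        (sum_mem fun k' hk' => mul_mem (hA₁ i hi k' hk') ?_)))
    · exact hout _ _ (fun h => Finset.mem_compl.1 hk h.1) l
    · exact hout _ _ (fun h => Finset.mem_compl.1 hk h.2) l
    · exact hout _ _ (fun h => Finset.mem_compl.1 hk h.2) l
  have hcard := (hρ.comp (fun t : (ι × ι) × κ => (t.1.1, t.1.2, t.2))
    (Equiv.prodAssoc ι ι κ).injective).card_le_of_mem_adjoin hmem
  have hX : X.card ≤ n * (Fintype.card ι - n) + r * (Fintype.card κ - r) + E.card * r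
      + (D.card - E.card) * Fintype.card κ := by
    refine (Finset.card_union_le _ _).trans (add_le_add ((Finset.card_union_le _ _).trans
      (add_le_add ((Finset.card_union_le _ _).trans (add_le_add ?_ ?_)) ?_)) ?_) <;>
    refine Finset.card_image_le.trans ?_ <;>
    simp [Finset.card_product, Finset.card_compl, hS, hS', Finset.card_sdiff_of_subset hED]
  have hE : E.card = n * (n - 1) / 2 := by rw [← hS]; exact S.card_filter_lt_product
  have hrκ : r ≤ Fintype.card κ := hS' ▸ S'.card_le_univ
  rw [← hE]
  rw [Finset.card_product, Finset.card_univ] at hcard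
  obtain ⟨s, hs⟩ := Nat.exists_eq_add_of_le hrκ
  obtain ⟨d, hd⟩ := Nat.exists_eq_add_of_le (Finset.card_le_card hED)
  replace hcard := hcard.trans hX
  rw [hs, hd] at hcard
  rw [hs]
  simp only [Nat.add_sub_cancel_left] at hcard ⊢
  rcases le_total E.card r with h | h
  · simp [Nat.sub_eq_zero_of_le h]
  · obtain ⟨e, he⟩ := Nat.exists_eq_add_of_le h
    rw [he] at hcard ⊢
    simp only [Nat.add_sub_cancel_left]
    nlinarith

theorem stmt16 (n q q' : ℕ) (hn : 0 < n) (hq : 0 < q) (hq' : 0 < q')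
    (hqq' : q = 2 * q' ∨ q = 2 * q' + 1)
    (hcond1 : 2 * q' ≤ n * (n - 1))
    (hcond2 : n ^ 2 < (q - q') * (n * (n - 1) / 2 - q'))
    (M Q : Type) [AddCommGroup M] [Module ℝ M] [AddCommGroup Q] [Module ℝ Q]
    (hM : Module.finrank ℝ M = 2 * n) (hQ : Module.finrank ℝ Q = q) :
    ∃ μ : M →ₗ[ℝ] M →ₗ[ℝ] Q,
      (∀ x y : M, μ x y = - μ y x) ∧
      Submodule.span ℝ {z : Q | ∃ x y : M, μ x y = z} = ⊤ ∧
      ∀ μC : (ℂ ⊗[ℝ] M) →ₗ[ℂ] (ℂ ⊗[ℝ] M) →ₗ[ℂ] (ℂ ⊗[ℝ] Q),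
        (∀ x y : M, μC ((1 : ℂ) ⊗ₜ[ℝ] x) ((1 : ℂ) ⊗ₜ[ℝ] y) = (1 : ℂ) ⊗ₜ[ℝ] (μ x y)) →
        ∀ W : Submodule ℂ (ℂ ⊗[ℝ] M), Module.finrank ℂ ↥W = n →
          ¬ (Module.finrank ℂ
              ↥(Submodule.span ℂ {z : ℂ ⊗[ℝ] Q | ∃ x ∈ W, ∃ y ∈ W, μC x y = z}) ≤ q') := by
  have : Module.Finite ℝ M := Module.finite_of_finrank_pos (by omega)
  have : Module.Finite ℝ Q := Module.finite_of_finrank_pos (by omega)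
  let b : Module.Basis (Fin (2 * n)) ℝ M := Module.finBasisOfFinrankEq ℝ M hM
  let c : Module.Basis (Fin q) ℝ Q := Module.finBasisOfFinrankEq ℝ Q hQ
  obtain ⟨ρ, hρ⟩ := exists_algebraicIndependent_real (Fin (2 * n) × Fin (2 * n) × Fin q)
  let v : Fin (2 * n) → Fin (2 * n) → Q := fun i j =>
    if i < j then ∑ l, ρ (i, j, l) • c l else if j < i then -∑ l, ρ (j, i, l) • c l else 0
  have hv : ∀ i j, v i j = -v j i := by
    intro i j
    rcases lt_trichotomy i j with h | rfl | h
    · simp [v, h, h.not_gt]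
    · simp [v]
    · simp [v, h, h.not_gt]
  let μ : M →ₗ[ℝ] M →ₗ[ℝ] Q := b.constr ℝ fun i => b.constr ℝ (v i)
  have hμ : ∀ i j, μ (b i) (b j) = v i j := fun i j => by simp [μ]
  have hμρ : ∀ i j, i < j → ∀ l, c.repr (μ (b i) (b j)) l = ρ (i, j, l) := fun i j hij l => by
    simp [hμ, v, hij, Finsupp.single_apply]
  have hμ' : ∀ i, μ (b i) (b i) = 0 := fun i => by simp [hμ, v]
  have hskew : μ = -μ.flip := b.ext fun i => b.ext fun j => by
    simpa [hμ] using hv i j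
  refine ⟨μ, fun x y => LinearMap.congr_fun₂ hskew x y, ?_, ?_⟩
  · have htop : {z : Q | ∃ x ∈ (⊤ : Submodule ℝ M), ∃ y ∈ (⊤ : Submodule ℝ M), μ x y = z} =
        {z : Q | ∃ x y : M, μ x y = z} := by simp
    have h := finrank_span_image_of_algebraicIndependent b c μ
      (fun i j => LinearMap.congr_fun₂ hskew _ _) hμ' hρ hμρ ⊤ (finrank_top ℝ M) (by rw [htop])
    simp only [hM, Fintype.card_fin, Nat.sub_self, Nat.mul_zero,
      Nat.le_zero, Nat.mul_eq_zero] at h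
    refine Submodule.eq_top_of_finrank_eq (le_antisymm (Submodule.finrank_le _) ?_)
    rw [hQ]
    have hN : q ≤ 2 * n * (2 * n - 1) / 2 := by
      obtain ⟨k, rfl⟩ : ∃ k, n = k + 1 := ⟨n - 1, by omega⟩
      rw [mul_assoc, Nat.mul_div_cancel_left _ two_pos]
      have : 2 * (k + 1) - 1 = 2 * k + 1 := by omega
      rw [this]
      simp only [Nat.add_sub_cancel] at hcond1
      have : 2 * q' + 1 ≤ (k + 1) * (2 * k + 1) := by nlinarith
      omega
    omega
  · intro μC hμC W hW hle
    have hρ' : AlgebraicIndependent ℚ (fun t => (ρ t : ℂ)) :=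
      hρ.map' (f := (Algebra.ofId ℝ ℂ).restrictScalars ℚ) (algebraMap ℝ ℂ).injective
    have h := finrank_span_image_of_algebraicIndependent (b.baseChange ℂ) (c.baseChange ℂ) μC
      (fun i j => by simp [Module.Basis.baseChange_apply, hμC, hμ, hv i j, TensorProduct.tmul_neg])
      (fun i => by simp [Module.Basis.baseChange_apply, hμC, hμ'])
      hρ' (fun i j hij l => by
        simp [Module.Basis.baseChange_apply, hμC, Module.Basis.baseChange_repr_tmul,
          hμρ i j hij]) W hW rfl
    rw [Fintype.card_fin, Fintype.card_fin, two_mul, Nat.add_sub_cancel, ← sq] at h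
    exact absurd (h.trans_lt hcond2) (not_lt.2
      (Nat.mul_le_mul (Nat.sub_le_sub_left hle _) (Nat.sub_le_sub_left hle _)))
end
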